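/- Let (u_i)_{i∈ℤ} be a real sequence with finite total variation, and let the updated sequence be v_i = u_i − D_i·(u_i − u_{i-1}) where 0 ≤ D_i ≤ 1 for all i. Then ∑_{i∈ℤ} |v_i − v_{i-1}| ≤ ∑_{i∈ℤ} |u_i − u_{i-1}|, i.e., the update is total variation diminishing. -/

import Mathlib

/-- If `vᵢ = uᵢ − Dᵢ (uᵢ − uᵢ₋₁)` with `0 ≤ Dᵢ ≤ 1`, the update is total
variation diminishing. -/
theorem tvd_half_incremental (u v D : ℤ → ℝ)
    (hD : ∀ i, 0 ≤ D i ∧ D i ≤ 1)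
    (hv : ∀ i, v i = u i - D i * (u i - u (i - 1)))
    (hTV : Summable fun i => |u i - u (i - 1)|) :
    (∑' i : ℤ, |v i - v (i - 1)|) ≤ ∑' i : ℤ, |u i - u (i - 1)| := by
  set a : ℤ → ℝ := fun i => u i - u (i - 1) with ha
  set g : ℤ → ℝ := fun i => D i * |a i| with hg
  have hgs : Summable g := hTV.of_nonneg_of_le
    (fun i => mul_nonneg (hD i).1 (abs_nonneg _))
    (fun i => mul_le_of_le_one_left (abs_nonneg _) (hD i).2)
  have hshift : HasSum (fun i => g (i - 1)) (∑' i, g i) :=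
    (Equiv.subRight (1 : ℤ)).hasSum_iff.mpr hgs.hasSum
  have hsum : HasSum (fun i => |a i| - g i + g (i - 1)) (∑' i, |a i|) := by
    simpa using (hTV.hasSum.sub hgs.hasSum).add hshift
  have hle : ∀ i, |v i - v (i - 1)| ≤ |a i| - g i + g (i - 1) := by
    intro i
    have hdiff : v i - v (i - 1) = (1 - D i) * a i + D (i - 1) * a (i - 1) := by
      rw [hv i, hv (i - 1)]
      simp only [ha]
      ring
    calc |v i - v (i - 1)| ≤ |(1 - D i) * a i| + |D (i - 1) * a (i - 1)| := by
          rw [hdiff]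
          exact abs_add_le _ _
      _ = |a i| - g i + g (i - 1) := by
          rw [abs_mul, abs_mul, abs_of_nonneg (sub_nonneg.mpr (hD i).2),
            abs_of_nonneg (hD (i - 1)).1]
          simp only [hg]
          ring
  have hvs : Summable fun i => |v i - v (i - 1)| :=
    hsum.summable.of_nonneg_of_le (fun _ => abs_nonneg _) hle
  exact hasSum_le hle hvs.hasSum hsum
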